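/- For integers k ≥ 2 and 1 ≤ m ≤ k−1, let h(m) = f(k,m+1) − f(k,m) = (1/k)·(H_{k−1} − H_m − 1). There exists an absolute constant c > 1 such that for every integer k ≥ c: (i) h(⌊k/e⌋ − 1) > 0 and h(⌊k/e⌋ + 1) < 0; (ii) the function m ↦ f(k,m) attains its maximum over m ∈ {1,…,k} at some m ∈ {⌊k/e⌋, ⌊k/e⌋ + 1}, is monotonically increasing for smaller values of m, and monotonically decreasing for larger values of m. -/

import Mathlib

/-- The `j`-th harmonic number `H_j = Σ_{i=1}^j 1/i` (with `H_0 = 0`). -/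
noncomputable def harm (j : ℕ) : ℝ := ∑ i ∈ Finset.range j, (1 : ℝ) / (i + 1)

/-- `f(k,m) = (m/k)·(H_{k−1} − H_{m−1})`. -/
noncomputable def f (k m : ℕ) : ℝ := ((m : ℝ) / k) * (harm (k - 1) - harm (m - 1))

/-- The discrete derivative `h(m) = f(k,m+1) − f(k,m)`. -/
noncomputable def h (k m : ℕ) : ℝ := f k (m + 1) - f k m

theorem harm_succ (j : ℕ) : harm (j + 1) = harm j + 1 / ((j : ℝ) + 1) := by
  simp [harm, Finset.sum_range_succ]

theorem harm_eq_harmonic (j : ℕ) : harm j = (harmonic j : ℝ) := by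
  simp [harm, harmonic]

theorem harm_mono : Monotone harm :=
  monotone_nat_of_le_succ fun j => by
    rw [harm_succ]
    have : (0 : ℝ) ≤ 1 / ((j : ℝ) + 1) := by positivity
    linarith

theorem h_eq {k m : ℕ} (hk : 0 < k) (hm : 1 ≤ m) :
    h k m = (1 / (k : ℝ)) * (harm (k - 1) - harm m - 1) := by
  obtain ⟨j, rfl⟩ := Nat.exists_eq_add_of_le' hm
  have hk' : (k : ℝ) ≠ 0 := by positivity
  have hj : (j : ℝ) + 1 ≠ 0 := by positivity
  simp only [h, f, Nat.add_sub_cancel, harm_succ]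
  push_cast
  field_simp
  ring

/-- Lower bound `log (b + 1) - log (a + 1) < H_b - H_a`. -/
theorem log_sub_log_lt_harm_sub_harm {a b : ℕ} (hab : a < b) :
    Real.log ((b : ℝ) + 1) - Real.log ((a : ℝ) + 1) < harm b - harm a := by
  have := Real.strictMono_eulerMascheroniSeq hab
  simp only [Real.eulerMascheroniSeq, ← harm_eq_harmonic] at this
  linarith

/-- Upper bound `H_b - H_a ≤ log b - log a`. -/
theorem harm_sub_harm_le_log_sub_log {a b : ℕ} (ha : 0 < a) (hab : a ≤ b) :
    harm b - harm a ≤ Real.log b - Real.log a := by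
  have := Real.strictAnti_eulerMascheroniSeq'.antitone hab
  simp only [Real.eulerMascheroniSeq', ha.ne', (ha.trans_le hab).ne', if_false,
    ← harm_eq_harmonic] at this
  linarith

theorem one_lt_harm_sub_harm {k n : ℕ} (hn : 1 ≤ n) (hnk : n < k)
    (hle : (n : ℝ) * Real.exp 1 ≤ k) : 1 < harm (k - 1) - harm (n - 1) := by
  obtain ⟨a, rfl⟩ := Nat.exists_eq_add_of_le' hn
  obtain ⟨b, rfl⟩ := Nat.exists_eq_add_of_le' (hn.trans hnk.le)
  have hlog := log_sub_log_lt_harm_sub_harm (a := a) (b := b) (by omega)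
  have hexp := Real.log_le_log (by positivity) hle
  push_cast at hexp
  rw [Real.log_mul (by positivity) (by positivity), Real.log_exp] at hexp
  simp only [Nat.add_sub_cancel]
  linarith

theorem harm_sub_harm_lt_one {k n : ℕ} (hn : 1 ≤ n) (hnk : n < k)
    (hlt : (k : ℝ) < n * Real.exp 1) : harm (k - 1) - harm n < 1 := by
  have hlog := harm_sub_harm_le_log_sub_log (b := k - 1) hn (by omega)
  have hn' : (0 : ℝ) < n := by positivity
  have hk' : (0 : ℝ) < ((k - 1 : ℕ) : ℝ) := by
    exact_mod_cast (by omega : 0 < k - 1)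
  have hle : ((k - 1 : ℕ) : ℝ) ≤ k := by exact_mod_cast Nat.sub_le k 1
  have hexp := Real.log_lt_log hk' (hle.trans_lt hlt)
  rw [Real.log_mul (by positivity) (by positivity), Real.log_exp] at hexp
  linarith

theorem f_le_f_of_h_nonneg {k a b : ℕ} (hab : a ≤ b)
    (hpos : ∀ m, a ≤ m → m < b → 0 ≤ h k m) : f k a ≤ f k b := by
  induction b, hab using Nat.le_induction with
  | base => exact le_rfl
  | succ b hab ih =>
    have hb := hpos b hab b.lt_succ_self
    have := ih fun m h₁ h₂ => hpos m h₁ (h₂.trans b.lt_succ_self)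
    unfold h at hb
    linarith

theorem f_le_f_of_h_nonpos {k a b : ℕ} (hab : a ≤ b)
    (hneg : ∀ m, a ≤ m → m < b → h k m ≤ 0) : f k b ≤ f k a := by
  induction b, hab using Nat.le_induction with
  | base => exact le_rfl
  | succ b hab ih =>
    have hb := hneg b hab b.lt_succ_self
    have := ih fun m h₁ h₂ => hneg m h₁ (h₂.trans b.lt_succ_self)
    unfold h at hb
    linarith

theorem h_antitone {k a b : ℕ} (hk : 0 < k) (ha : 1 ≤ a) (hab : a ≤ b) : h k b ≤ h k a := by
  rw [h_eq hk ha, h_eq hk (ha.trans hab)]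
  have := harm_mono hab
  gcongr

/-- **Location of the maximum of `f(k,·)`.**
One has `h(m) = (1/k)·(H_{k−1} − H_m − 1)`, and there is an absolute constant
`c > 1` such that for every `k ≥ c`: (i) `h(⌊k/e⌋ − 1) > 0` and
`h(⌊k/e⌋ + 1) < 0`; (ii) `f(k,·)` attains its maximum over `{1,…,k}` at some
`m* ∈ {⌊k/e⌋, ⌊k/e⌋ + 1}`, is monotonically increasing for `m ≤ m*` and
monotonically decreasing for `m ≥ m*`. -/
theorem f_discrete_derivative_and_maximum :
    ∃ c : ℕ, 1 < c ∧ ∀ k : ℕ, c ≤ k →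
      (∀ m : ℕ, 1 ≤ m → m ≤ k - 1 →
        h k m = (1 / (k : ℝ)) * (harm (k - 1) - harm m - 1)) ∧
      0 < h k (⌊(k : ℝ) / Real.exp 1⌋₊ - 1) ∧
      h k (⌊(k : ℝ) / Real.exp 1⌋₊ + 1) < 0 ∧
      ∃ m' : ℕ, (m' = ⌊(k : ℝ) / Real.exp 1⌋₊ ∨ m' = ⌊(k : ℝ) / Real.exp 1⌋₊ + 1) ∧
        (∀ m : ℕ, 1 ≤ m → m ≤ k → f k m ≤ f k m') ∧
        (∀ m₁ m₂ : ℕ, 1 ≤ m₁ → m₁ ≤ m₂ → m₂ ≤ m' → f k m₁ ≤ f k m₂) ∧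
        (∀ m₁ m₂ : ℕ, m' ≤ m₁ → m₁ ≤ m₂ → m₂ ≤ k → f k m₂ ≤ f k m₁) := by
  refine ⟨6, by norm_num, fun k hk => ?_⟩
  have hk0 : 0 < k := by omega
  have hkR : (6 : ℝ) ≤ k := by exact_mod_cast hk
  have he1 := Real.exp_one_gt_d9
  have he2 := Real.exp_one_lt_d9
  set n := ⌊(k : ℝ) / Real.exp 1⌋₊ with hn_def
  have hn2 : 2 ≤ n := by
    refine Nat.le_floor ?_
    rw [le_div_iff₀ (by positivity)]
    push_cast
    linarith
  have hle : (n : ℝ) * Real.exp 1 ≤ k := by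
    rw [← le_div_iff₀ (by positivity)]
    exact Nat.floor_le (by positivity)
  have hlt : (k : ℝ) < ((n + 1 : ℕ) : ℝ) * Real.exp 1 := by
    rw [← div_lt_iff₀ (by positivity)]
    push_cast
    exact Nat.lt_floor_add_one _
  have hn2R : (2 : ℝ) ≤ n := by exact_mod_cast hn2
  have hnk : n + 1 < k := by
    have : (n : ℝ) + 1 < k := by nlinarith
    exact_mod_cast this
  have hpos : 0 < h k (n - 1) := by
    rw [h_eq hk0 (by omega)]
    have := one_lt_harm_sub_harm (by omega) (by omega) hle
    exact mul_pos (by positivity) (by linarith)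
  have hneg : h k (n + 1) < 0 := by
    rw [h_eq hk0 (by omega)]
    have := harm_sub_harm_lt_one (by omega) hnk hlt
    exact mul_neg_of_pos_of_neg (by positivity) (by linarith)
  refine ⟨fun m hm _ => h_eq hk0 hm, hpos, hneg, ?_⟩
  obtain ⟨m', hm', hup, hdown⟩ : ∃ m' : ℕ, (m' = n ∨ m' = n + 1) ∧
      (∀ m, 1 ≤ m → m < m' → 0 ≤ h k m) ∧ (∀ m, m' ≤ m → h k m ≤ 0) := by
    rcases le_total 0 (h k n) with hn | hn
    · exact ⟨n + 1, Or.inr rfl,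
        fun m h₁ h₂ => hn.trans (h_antitone hk0 h₁ (by omega)),
        fun m h₁ => (h_antitone hk0 (by omega) h₁).trans hneg.le⟩
    · exact ⟨n, Or.inl rfl,
        fun m h₁ h₂ => hpos.le.trans (h_antitone hk0 h₁ (by omega)),
        fun m h₁ => (h_antitone hk0 (by omega) h₁).trans hn⟩
  have hincr : ∀ m₁ m₂ : ℕ, 1 ≤ m₁ → m₁ ≤ m₂ → m₂ ≤ m' → f k m₁ ≤ f k m₂ :=
    fun m₁ m₂ h₁ h₁₂ h₂ => f_le_f_of_h_nonneg h₁₂ fun m ha hb =>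
      hup m (h₁.trans ha) (hb.trans_le h₂)
  have hdecr : ∀ m₁ m₂ : ℕ, m' ≤ m₁ → m₁ ≤ m₂ → m₂ ≤ k → f k m₂ ≤ f k m₁ :=
    fun m₁ m₂ h₁ h₁₂ _ => f_le_f_of_h_nonpos h₁₂ fun m ha _ => hdown m (h₁.trans ha)
  refine ⟨m', hm', fun m h₁ h₂ => ?_, hincr, hdecr⟩
  rcases le_total m m' with hm | hm
  · exact hincr m m' h₁ hm le_rfl
  · exact hdecr m' m le_rfl hm h₂
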